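/- arXiv:2505.01472 — 2 statements merged into one kernel-verified Lean document; each statement's English description precedes it below -/
import Mathlib

section
/- The two-stage adaptive tabulation mechanism satisfies ρ-zCDP: Fix ρ > 0, γ ∈ (0,1), integer thresholds Θ_1 ≤ Θ_2 ≤ Θ_3, and four fixed partitions f_1, f_2, f_3, f_4 of the record domain into finitely many cells. On input database x, the mechanism first outputs Y_0 = |x| + Z_0 where Z_0 ∼ N_Z(1/(2γρ)); then, depending on which of the thresholds Θ_1, Θ_2, Θ_3 the value Y_0 exceeds, it selects one of the four partitions f_t and outputs the vector of cell counts of x under f_t, each perturbed by an independent N_Z(1/(2(1−γ)ρ)) noise sample. This mechanism satisfies ρ-zCDP with respect to the addition or removal of one record. -/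
open scoped BigOperators ENNReal

/-- Rényi divergence of order `α` between two discrete distributions. -/
noncomputable def renyiDiv {β : Type*} (α : ℝ) (P Q : PMF β) : ℝ :=
  (α - 1)⁻¹ * Real.log (∑' b : β, (P b).toReal ^ α * (Q b).toReal ^ (1 - α))

/-- Two databases (multisets of records) are neighbors if their symmetric
difference contains exactly one record. -/
def Neighbor {I : Type*} [DecidableEq I] (x x' : Multiset I) : Prop :=
  ((x - x') + (x' - x)).card = 1

/-- A randomized mechanism `M` satisfies `ρ`-zCDP. -/
def zCDP {I β : Type*} [DecidableEq I] (M : Multiset I → PMF β) (ρ : ℝ) : Prop :=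
  ∀ x x' : Multiset I, Neighbor x x' → ∀ α : ℝ, 1 < α →
    renyiDiv α (M x) (M x') ≤ α * ρ

universe u

/-- Product of finitely many independent distributions, indexed by `Fin n`. -/
noncomputable def pmfPiFin : (n : ℕ) → (β : Fin n → Type u) →
    ((i : Fin n) → PMF (β i)) → PMF ((i : Fin n) → β i)
  | 0, _, _ => PMF.pure (fun i => i.elim0)
  | n + 1, β, p =>
      (p 0).bind fun b0 =>
        (pmfPiFin n (fun i => β i.succ) (fun i => p i.succ)).bind fun f =>
          PMF.pure (Fin.cons b0 f)

/-- Product of independent distributions indexed by a finite type. -/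
noncomputable def pmfPi {ι : Type*} [Fintype ι] {β : ι → Type*}
    (p : (i : ι) → PMF (β i)) : PMF ((i : ι) → β i) :=
  (pmfPiFin (Fintype.card ι) (fun k => β ((Fintype.equivFin ι).symm k))
      (fun k => p ((Fintype.equivFin ι).symm k))).map
    ⇑(Equiv.piCongrLeft' β (Fintype.equivFin ι)).symm

open scoped ENNReal

/-- The (real-valued) unnormalized discrete Gaussian mass function. -/
noncomputable def dgaussMass (σ2 : ℝ) (y : ℤ) : ℝ :=
  Real.exp (-(y : ℝ) ^ 2 / (2 * σ2))

lemma dgaussMass_summable {σ2 : ℝ} (h : 0 < σ2) : Summable (dgaussMass σ2) := by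
  have h2 : (0 : ℝ) < 2 * σ2 := by linarith
  have hgeo : Summable fun n : ℕ => Real.exp ((n : ℝ) * (-(2 * σ2)⁻¹)) :=
    Real.summable_exp_nat_mul_iff.mpr (by rw [neg_lt_zero]; positivity)
  have hnat : Summable fun n : ℕ => dgaussMass σ2 (n : ℤ) := by
    apply Summable.of_nonneg_of_le (fun n => (Real.exp_pos _).le) ?_ hgeo
    intro n
    apply Real.exp_le_exp.mpr
    have hn : (n : ℝ) ≤ (n : ℝ) ^ 2 := by exact_mod_cast Nat.le_self_pow two_ne_zero n
    push_cast [dgaussMass]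
    rw [show (n : ℝ) * (-(2 * σ2)⁻¹) = -((n : ℝ) / (2 * σ2)) by ring,
      show -(n : ℝ) ^ 2 / (2 * σ2) = -((n : ℝ) ^ 2 / (2 * σ2)) by ring]
    apply neg_le_neg
    gcongr
  apply Summable.of_nat_of_neg hnat
  have : ∀ n : ℕ, dgaussMass σ2 (-(n : ℤ)) = dgaussMass σ2 (n : ℤ) := by
    intro n; simp [dgaussMass]
  simpa only [this] using hnat

lemma dgaussMass_pos (σ2 : ℝ) (y : ℤ) : 0 < dgaussMass σ2 y := Real.exp_pos _

lemma dgaussMass_tsum_pos {σ2 : ℝ} (h : 0 < σ2) : 0 < ∑' y : ℤ, dgaussMass σ2 y :=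
  Summable.tsum_pos (dgaussMass_summable h) (fun y => (dgaussMass_pos σ2 y).le) 0 (dgaussMass_pos σ2 0)

/-- The discrete Gaussian distribution `N_ℤ(σ²)` centered at `0`, as a `PMF` on `ℤ`
(defined to be a point mass when `σ² ≤ 0`). -/
noncomputable def dgaussPMF (σ2 : ℝ) : PMF ℤ :=
  if h : 0 < σ2 then
    ⟨fun x => ENNReal.ofReal (dgaussMass σ2 x / ∑' y : ℤ, dgaussMass σ2 y), by
      have hS : (0 : ℝ) < ∑' y : ℤ, dgaussMass σ2 y := dgaussMass_tsum_pos h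
      have key : ∑' x : ℤ, ENNReal.ofReal (dgaussMass σ2 x / ∑' y : ℤ, dgaussMass σ2 y) = 1 := by
        rw [← ENNReal.ofReal_tsum_of_nonneg (fun x => div_nonneg (dgaussMass_pos σ2 x).le hS.le)
          ((dgaussMass_summable h).div_const _), tsum_div_const, div_self hS.ne',
          ENNReal.ofReal_one]
      exact key ▸ ENNReal.summable.hasSum⟩
  else PMF.pure 0

/-- The two-stage adaptive tabulation mechanism with budget `ρ` and split `γ`:
first release a noisy total count `y0` of the database using discrete Gaussian noise of
variance `1/(2γρ)`; then, depending on which of the thresholds `Θ1 ≤ Θ2 ≤ Θ3` the noisy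
count exceeds, select one of four fixed partitions of the record domain (partition `t`
has `n t` cells, given by `part t : I → Fin (n t)`) and release all of its cell counts,
each perturbed by independent discrete Gaussian noise of variance `1/(2(1-γ)ρ)`. -/
noncomputable def twoStage {I : Type*} (n : Fin 4 → ℕ) (part : (t : Fin 4) → I → Fin (n t))
    (Θ1 Θ2 Θ3 : ℤ) (ρ γ : ℝ) (x : Multiset I) :
    PMF (ℤ × Σ t : Fin 4, (Fin (n t) → ℤ)) :=
  (dgaussPMF (1 / (2 * γ * ρ))).bind fun z0 =>
    let y0 : ℤ := (Multiset.card x : ℤ) + z0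
    let t : Fin 4 := if y0 < Θ1 then 0 else if y0 < Θ2 then 1 else if y0 < Θ3 then 2 else 3
    (pmfPi fun _ : Fin (n t) => dgaussPMF (1 / (2 * (1 - γ) * ρ))).bind fun noise =>
      PMF.pure (y0, ⟨t, fun c => ((x.filter fun r => part t r = c).card : ℤ) + noise c⟩)

lemma aux_theta (a : ℝ) (ha : 0 < a) (m : ℝ) :
    Summable (fun n : ℤ => Real.exp (-Real.pi / a * ((n : ℝ) - m) ^ 2)) ∧
    ∑' n : ℤ, Real.exp (-Real.pi / a * ((n : ℝ) - m) ^ 2) ≤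
      ∑' n : ℤ, Real.exp (-Real.pi / a * (n : ℝ) ^ 2) := by
  have hac : 0 < (a : ℂ).re := by simpa using ha
  have hsum0 : Summable (fun n : ℤ => Real.exp (-Real.pi * a * (n : ℝ) ^ 2)) := by
    have h := dgaussMass_summable (σ2 := 1 / (2 * Real.pi * a)) (by positivity)
    refine h.congr fun n => ?_
    unfold dgaussMass
    congr 1
    have := Real.pi_pos
    field_simp
  have hsq : (0 : ℝ) < a ^ (1 / 2 : ℝ) := by positivity
  have key := Complex.tsum_exp_neg_quadratic hac (Complex.I * m)
  have key0 := Real.tsum_exp_neg_mul_int_sq ha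
  have e1 : ∀ n : ℤ, Complex.exp (-Real.pi / a * ((n : ℂ) + Complex.I * (Complex.I * m)) ^ 2)
      = ((Real.exp (-Real.pi / a * ((n : ℝ) - m) ^ 2) : ℝ) : ℂ) := by
    intro n
    push_cast
    congr 3
    rw [← mul_assoc, Complex.I_mul_I]; ring
  simp_rw [e1] at key
  rw [← Complex.ofReal_tsum] at key
  have hsumm : Summable (fun n : ℤ => Real.exp (-Real.pi / a * ((n : ℝ) - m) ^ 2)) := by
    have hd := dgaussMass_summable (σ2 := a / Real.pi) (by positivity)
    have hd' := hd.mul_left (Real.exp (Real.pi / a * m ^ 2))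
    refine Summable.of_nonneg_of_le (fun n => (Real.exp_pos _).le) (fun n => ?_) hd'
    unfold dgaussMass
    rw [← Real.exp_add]
    apply Real.exp_le_exp.mpr
    have hpi := Real.pi_pos
    have : Real.pi / a * m ^ 2 + -(n : ℝ) ^ 2 / (2 * (a / Real.pi))
        - (-Real.pi / a * ((n : ℝ) - m) ^ 2) = Real.pi / a * (2 * ((n : ℝ) / 2 - m) ^ 2) := by
      field_simp
      ring
    have h2 : 0 ≤ Real.pi / a * (2 * ((n : ℝ) / 2 - m) ^ 2) := by positivity
    linarith
  refine ⟨hsumm, ?_⟩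
  have hn := congrArg norm key
  have hle : ‖∑' n : ℤ, Complex.exp (-Real.pi * a * (n : ℂ) ^ 2 + 2 * Real.pi * (Complex.I * m) * n)‖
      ≤ ∑' n : ℤ, Real.exp (-Real.pi * a * (n : ℝ) ^ 2) := by
    refine tsum_of_norm_bounded hsum0.hasSum fun n => ?_
    rw [Complex.norm_exp]
    apply Real.exp_le_exp.mpr
    apply le_of_eq
    have : (-Real.pi * a * (n : ℂ) ^ 2 + 2 * Real.pi * (Complex.I * m) * n : ℂ)
      = ((-Real.pi * a * (n : ℝ) ^ 2 : ℝ) : ℂ) + ((2 * Real.pi * m * n : ℝ) : ℂ) * Complex.I := by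
      push_cast; ring
    rw [this]
    rw [Complex.add_re, Complex.ofReal_re, Complex.re_ofReal_mul, Complex.I_re]
    ring
  rw [hn, key0] at hle
  have hc : ((1 : ℂ) / (a : ℂ) ^ (1 / 2 : ℂ)) = ((1 / a ^ (1 / 2 : ℝ) : ℝ) : ℂ) := by
    push_cast [Complex.ofReal_cpow ha.le]
    rfl
  rw [hc, ← Complex.ofReal_mul, Complex.norm_real, Real.norm_eq_abs,
    abs_of_nonneg (mul_nonneg (by positivity) (tsum_nonneg fun _ => (Real.exp_pos _).le))] at hle
  exact le_of_mul_le_mul_left hle (by positivity)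

noncomputable def auxH (σ2 α : ℝ) (a b : ℤ) (v : ℤ) : ℝ :=
  (dgaussPMF σ2 (v - a)).toReal ^ α * (dgaussPMF σ2 (v - b)).toReal ^ (1 - α)

lemma dgaussPMF_toReal {σ2 : ℝ} (h : 0 < σ2) (x : ℤ) :
    (dgaussPMF σ2 x).toReal = dgaussMass σ2 x / ∑' y : ℤ, dgaussMass σ2 y := by
  have hS := dgaussMass_tsum_pos h
  have : dgaussPMF σ2 x = ENNReal.ofReal (dgaussMass σ2 x / ∑' y : ℤ, dgaussMass σ2 y) := by
    have e : dgaussPMF σ2 = _ := dif_pos h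
    rw [e]
    rfl
  rw [this, ENNReal.toReal_ofReal (div_nonneg (dgaussMass_pos _ _).le hS.le)]

lemma auxH_nonneg (σ2 α : ℝ) (a b v : ℤ) : 0 ≤ auxH σ2 α a b v :=
  mul_nonneg (Real.rpow_nonneg ENNReal.toReal_nonneg _) (Real.rpow_nonneg ENNReal.toReal_nonneg _)

lemma auxH_bound {σ2 : ℝ} (h : 0 < σ2) (α : ℝ) (a b : ℤ) :
    ∑' v : ℤ, ENNReal.ofReal (auxH σ2 α a b v) ≤
      ENNReal.ofReal (Real.exp (α * (α - 1) * ((a : ℝ) - b) ^ 2 / (2 * σ2))) := by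
  have hpi := Real.pi_pos
  set S := ∑' y : ℤ, dgaussMass σ2 y with hSdef
  have hS : 0 < S := dgaussMass_tsum_pos h
  set m : ℝ := α * a + (1 - α) * b with hm
  set C : ℝ := Real.exp (α * (α - 1) * ((a : ℝ) - b) ^ 2 / (2 * σ2)) with hC
  have hA : (0 : ℝ) < 2 * Real.pi * σ2 := by positivity
  obtain ⟨hs, hle⟩ := aux_theta _ hA m
  have e0 : ∑' n : ℤ, Real.exp (-Real.pi / (2 * Real.pi * σ2) * (n : ℝ) ^ 2) = S := by
    rw [hSdef]
    refine tsum_congr fun n => ?_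
    unfold dgaussMass
    congr 1
    field_simp
  rw [e0] at hle
  have e1 : ∀ v : ℤ, auxH σ2 α a b v =
      C / S * Real.exp (-Real.pi / (2 * Real.pi * σ2) * ((v : ℝ) - m) ^ 2) := by
    intro v
    unfold auxH
    rw [dgaussPMF_toReal h, dgaussPMF_toReal h, ← hSdef,
      Real.div_rpow (dgaussMass_pos _ _).le hS.le, Real.div_rpow (dgaussMass_pos _ _).le hS.le,
      div_mul_div_comm, ← Real.rpow_add hS]
    unfold dgaussMass
    rw [← Real.exp_mul, ← Real.exp_mul, ← Real.exp_add, hC, div_mul_eq_mul_div (Real.exp _) S,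
      ← Real.exp_add]
    congr 1
    · congr 1
      rw [hm]
      push_cast
      field_simp
      ring
    · rw [add_sub_cancel, Real.rpow_one]
  simp_rw [e1]
  have hCp : 0 < C := Real.exp_pos _
  rw [← ENNReal.ofReal_tsum_of_nonneg (fun n => by positivity) (hs.mul_left _), tsum_mul_left]
  apply ENNReal.ofReal_le_ofReal
  calc C / S * _ ≤ C / S * S := by gcongr
    _ = C := by field_simp

lemma pmfPiFin_apply : ∀ (n : ℕ) (β : Fin n → Type u) (p : (i : Fin n) → PMF (β i))
    (f : (i : Fin n) → β i), pmfPiFin n β p f = ∏ i, p i (f i)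
  | 0, β, p, f => by
      simp only [pmfPiFin, Finset.univ_eq_empty, Finset.prod_empty]
      rw [PMF.pure_apply, if_pos (Subsingleton.elim _ _)]
  | n + 1, β, p, f => by
      simp only [pmfPiFin]
      rw [PMF.bind_apply, tsum_eq_single (f 0), Fin.prod_univ_succ]
      · congr 1
        rw [PMF.bind_apply, tsum_eq_single (fun i : Fin n => f i.succ), pmfPiFin_apply n]
        · rw [PMF.pure_apply, if_pos (by exact (Fin.cons_self_tail f).symm), mul_one]
        · intro g hg
          rw [PMF.pure_apply, if_neg, mul_zero]
          rintro h
          apply hg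
          funext i
          rw [h, Fin.cons_succ]
      · intro b hb
        rw [PMF.bind_apply]
        have : ∀ g, (pmfPiFin n (fun i => β i.succ) (fun i => p i.succ)) g *
            (PMF.pure (Fin.cons b g : (i : Fin (n + 1)) → β i)) f = 0 := by
          intro g
          rw [PMF.pure_apply, if_neg, mul_zero]
          rintro h
          apply hb
          rw [h, Fin.cons_zero]
        simp only [this, tsum_zero, mul_zero]

lemma pmfMapEquiv {A B : Type*} (e : A ≃ B) (p : PMF A) (b : B) :
    p.map e b = p (e.symm b) := by
  rw [PMF.map_apply, tsum_eq_single (e.symm b)]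
  · simp
  · intro a ha
    rw [if_neg]
    rintro rfl
    simp at ha

lemma pmfPi_apply {ι : Type*} [Fintype ι] {B : Type*} (p : ι → PMF B) (f : ι → B) :
    pmfPi p f = ∏ i, p i (f i) := by
  unfold pmfPi
  rw [pmfMapEquiv, pmfPiFin_apply]
  exact Equiv.prod_comp (Fintype.equivFin ι).symm (fun i => p i (f i))

lemma ennreal_tsum_pi {B : Type*} : ∀ (n : ℕ) (h : Fin n → B → ℝ≥0∞),
    ∑' v : Fin n → B, ∏ i, h i (v i) = ∏ i, ∑' b, h i b
  | 0, h => by simp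
  | n + 1, h => by
      rw [← (Fin.consEquiv (fun _ : Fin (n + 1) => B)).tsum_eq, ENNReal.tsum_prod',
        Fin.prod_univ_succ, ← ennreal_tsum_pi n, ← ENNReal.tsum_mul_right]
      refine tsum_congr fun b => ?_
      rw [← ENNReal.tsum_mul_left]
      refine tsum_congr fun v => ?_
      simp [Fin.consEquiv, Fin.prod_univ_succ]

def auxT (Θ1 Θ2 Θ3 y0 : ℤ) : Fin 4 :=
  if y0 < Θ1 then 0 else if y0 < Θ2 then 1 else if y0 < Θ3 then 2 else 3

def auxCnt {I : Type*} {n : ℕ} (part : I → Fin n) (x : Multiset I) (c : Fin n) : ℤ :=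
  ((x.filter fun r => part r = c).card : ℤ)

noncomputable def auxK {I : Type*} (n : Fin 4 → ℕ) (part : (t : Fin 4) → I → Fin (n t))
    (s2 : ℝ) (x : Multiset I) (y0 : ℤ) (t : Fin 4) : PMF (ℤ × Σ t : Fin 4, (Fin (n t) → ℤ)) :=
  (pmfPi fun _ : Fin (n t) => dgaussPMF s2).bind fun noise =>
      PMF.pure (y0, ⟨t, fun c => auxCnt (part t) x c + noise c⟩)

lemma auxK_apply {I : Type*} (n : Fin 4 → ℕ) (part : (t : Fin 4) → I → Fin (n t))
    (s2 : ℝ) (x : Multiset I) (y0 : ℤ) (t : Fin 4) (v : Fin (n t) → ℤ) :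
    auxK n part s2 x y0 t (y0, ⟨t, v⟩) = ∏ c, dgaussPMF s2 (v c - auxCnt (part t) x c) := by
  unfold auxK
  rw [PMF.bind_apply, tsum_eq_single (fun c => v c - auxCnt (part t) x c)]
  · rw [pmfPi_apply, PMF.pure_apply, if_pos (by simp), mul_one]
  · intro w hw
    rw [PMF.pure_apply, if_neg, mul_zero]
    intro h
    apply hw
    simp only [Prod.mk.injEq, true_and, Sigma.mk.injEq, heq_eq_eq] at h
    funext c
    rw [h]
    simp

lemma auxK_apply_ne {I : Type*} (n : Fin 4 → ℕ) (part : (t : Fin 4) → I → Fin (n t))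
    (s2 : ℝ) (x : Multiset I) (y0 y : ℤ) (t s : Fin 4) (v : Fin (n s) → ℤ)
    (h : ¬ (y = y0 ∧ s = t)) :
    auxK n part s2 x y0 t (y, ⟨s, v⟩) = 0 := by
  unfold auxK
  rw [PMF.bind_apply, ENNReal.tsum_eq_zero]
  intro w
  rw [PMF.pure_apply, if_neg, mul_zero]
  intro h'
  apply h
  rw [Prod.mk.injEq, Sigma.mk.injEq] at h'
  exact ⟨h'.1, h'.2.1⟩

lemma twoStage_apply' {I : Type*} (n : Fin 4 → ℕ) (part : (t : Fin 4) → I → Fin (n t))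
    (Θ1 Θ2 Θ3 : ℤ) (ρ γ : ℝ) (x : Multiset I) (y : ℤ) (s : Fin 4) (v : Fin (n s) → ℤ) :
    twoStage n part Θ1 Θ2 Θ3 ρ γ x (y, ⟨s, v⟩) =
      dgaussPMF (1 / (2 * γ * ρ)) (y - x.card) *
        auxK n part (1 / (2 * (1 - γ) * ρ)) x y (auxT Θ1 Θ2 Θ3 y) (y, ⟨s, v⟩) := by
  have : twoStage n part Θ1 Θ2 Θ3 ρ γ x = (dgaussPMF (1 / (2 * γ * ρ))).bind fun z0 =>
      auxK n part (1 / (2 * (1 - γ) * ρ)) x (x.card + z0) (auxT Θ1 Θ2 Θ3 (x.card + z0)) := rfl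
  rw [this, PMF.bind_apply, tsum_eq_single (y - x.card)]
  · rw [add_sub_cancel]
  · intro z hz
    rw [auxK_apply_ne, mul_zero]
    rintro ⟨h, -⟩
    apply hz
    omega

lemma neighbor_bounds {I : Type*} [DecidableEq I] {x x' : Multiset I} (h : Neighbor x x') :
    (((x.card : ℤ) : ℝ) - ((x'.card : ℤ) : ℝ)) ^ 2 = 1 ∧
    ∀ (n : ℕ) (part : I → Fin n),
      ∑ c, ((auxCnt part x c : ℝ) - (auxCnt part x' c : ℝ)) ^ 2 = 1 := by
  have key : ∀ (r : I) (z : Multiset I),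
      ((((r ::ₘ z).card : ℤ) : ℝ) - ((z.card : ℤ) : ℝ)) ^ 2 = 1 ∧
      ∀ (n : ℕ) (part : I → Fin n),
      ∑ c, ((auxCnt part (r ::ₘ z) c : ℝ) - (auxCnt part z c : ℝ)) ^ 2 = 1 := by
    intro r z
    refine ⟨by simp, fun n part => ?_⟩
    have : ∀ c, ((auxCnt part (r ::ₘ z) c : ℝ) - (auxCnt part z c : ℝ)) ^ 2
        = if part r = c then 1 else 0 := by
      intro c
      unfold auxCnt
      by_cases hc : part r = c
      · rw [Multiset.filter_cons_of_pos (s := z) (p := fun r => part r = c) hc]; simp [hc]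
      · rw [Multiset.filter_cons_of_neg (s := z) (p := fun r => part r = c) hc]; simp [hc]
    simp [this]
  have base : ∀ u w : Multiset I, (u - w).card = 1 → (w - u).card = 0 → ∃ r, u = r ::ₘ w := by
    intro u w h1 h0
    obtain ⟨r, hr⟩ := Multiset.card_eq_one.mp h1
    have hle : w ≤ u := tsub_eq_zero_iff_le.mp (Multiset.card_eq_zero.mp h0)
    refine ⟨r, ?_⟩
    rw [← tsub_add_cancel_of_le hle, hr]
    simp
  unfold Neighbor at h
  rw [Multiset.card_add] at h
  rcases (by omega : ((x - x').card = 1 ∧ (x' - x).card = 0) ∨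
    ((x' - x).card = 1 ∧ (x - x').card = 0)) with ⟨h1, h0⟩ | ⟨h1, h0⟩
  · obtain ⟨r, rfl⟩ := base _ _ h1 h0
    exact key r x'
  · obtain ⟨r, rfl⟩ := base _ _ h1 h0
    obtain ⟨k1, k2⟩ := key r x
    refine ⟨by rw [← k1]; ring, fun n part => ?_⟩
    rw [← k2 n part]
    exact Finset.sum_congr rfl fun c _ => by ring

lemma renyi_le {B : Type*} (α c : ℝ) (hα : 1 < α) (hc : 0 ≤ c) (P Q : PMF B)
    (h : ∑' b, ENNReal.ofReal ((P b).toReal ^ α * (Q b).toReal ^ (1 - α)) ≤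
      ENNReal.ofReal (Real.exp ((α - 1) * c))) : renyiDiv α P Q ≤ c := by
  have h1 : 0 < α - 1 := by linarith
  have hnn : ∀ b, 0 ≤ (P b).toReal ^ α * (Q b).toReal ^ (1 - α) := fun b =>
    mul_nonneg (Real.rpow_nonneg ENNReal.toReal_nonneg _) (Real.rpow_nonneg ENNReal.toReal_nonneg _)
  unfold renyiDiv
  rw [inv_mul_le_iff₀ h1]
  by_cases hs : Summable fun b => (P b).toReal ^ α * (Q b).toReal ^ (1 - α)
  · rw [← ENNReal.ofReal_tsum_of_nonneg hnn hs,
      ENNReal.ofReal_le_ofReal_iff (Real.exp_pos _).le] at h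
    rcases (tsum_nonneg hnn).eq_or_lt with h0 | h0
    · rw [← h0, Real.log_zero]; positivity
    · exact (Real.log_le_iff_le_exp h0).mpr h
  · rw [tsum_eq_zero_of_not_summable hs, Real.log_zero]; positivity

/-- The two-stage adaptive tabulation mechanism satisfies `ρ`-zCDP
with respect to the addition or removal of one record. -/
theorem twoStage_zCDP {I : Type*} [DecidableEq I]
    (ρ γ : ℝ) (hρ : 0 < ρ) (hγ0 : 0 < γ) (hγ1 : γ < 1)
    (Θ1 Θ2 Θ3 : ℤ) (hΘ12 : Θ1 ≤ Θ2) (hΘ23 : Θ2 ≤ Θ3)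
    (n : Fin 4 → ℕ) (part : (t : Fin 4) → I → Fin (n t)) :
    zCDP (twoStage n part Θ1 Θ2 Θ3 ρ γ) ρ := by
  intro x x' hN α hα
  obtain ⟨hcard, hcnt⟩ := neighbor_bounds hN
  have hα0 : 0 < α := by linarith
  have h1γ : 0 < 1 - γ := by linarith
  apply renyi_le α (α * ρ) hα (by positivity)
  set s1 : ℝ := 1 / (2 * γ * ρ) with hs1
  set s2 : ℝ := 1 / (2 * (1 - γ) * ρ) with hs2
  have hs1p : 0 < s1 := by positivity
  have hs2p : 0 < s2 := by positivity
  rw [ENNReal.tsum_prod']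
  have hy : ∀ y : ℤ, ∑' b : (Σ t : Fin 4, (Fin (n t) → ℤ)),
      ENNReal.ofReal ((twoStage n part Θ1 Θ2 Θ3 ρ γ x (y, b)).toReal ^ α *
        (twoStage n part Θ1 Θ2 Θ3 ρ γ x' (y, b)).toReal ^ (1 - α)) ≤
      ENNReal.ofReal (auxH s1 α x.card x'.card y) *
        ENNReal.ofReal (Real.exp (α * (α - 1) / (2 * s2))) := by
    intro y
    rw [ENNReal.tsum_sigma', tsum_eq_single (auxT Θ1 Θ2 Θ3 y)]
    · set t := auxT Θ1 Θ2 Θ3 y with ht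
      have e : ∀ v : Fin (n t) → ℤ,
          ENNReal.ofReal ((twoStage n part Θ1 Θ2 Θ3 ρ γ x (y, ⟨t, v⟩)).toReal ^ α *
            (twoStage n part Θ1 Θ2 Θ3 ρ γ x' (y, ⟨t, v⟩)).toReal ^ (1 - α)) =
          ENNReal.ofReal (auxH s1 α x.card x'.card y) * ∏ c, ENNReal.ofReal
            (auxH s2 α (auxCnt (part t) x c) (auxCnt (part t) x' c) (v c)) := by
        intro v
        rw [twoStage_apply', twoStage_apply', ← ht, auxK_apply, auxK_apply, ← hs1, ← hs2,
          ← ENNReal.ofReal_prod_of_nonneg (fun c _ => auxH_nonneg _ _ _ _ _),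
          ← ENNReal.ofReal_mul (auxH_nonneg _ _ _ _ _)]
        congr 1
        unfold auxH
        rw [Finset.prod_mul_distrib, ENNReal.toReal_mul, ENNReal.toReal_mul,
          ENNReal.toReal_prod, ENNReal.toReal_prod,
          Real.mul_rpow ENNReal.toReal_nonneg (Finset.prod_nonneg fun _ _ => ENNReal.toReal_nonneg),
          Real.mul_rpow ENNReal.toReal_nonneg (Finset.prod_nonneg fun _ _ => ENNReal.toReal_nonneg),
          Real.finsetProd_rpow _ _ (fun _ _ => ENNReal.toReal_nonneg),
          Real.finsetProd_rpow _ _ (fun _ _ => ENNReal.toReal_nonneg)]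
        ring
      simp_rw [e]
      rw [ENNReal.tsum_mul_left]
      gcongr
      rw [ennreal_tsum_pi (n t) (fun c b => ENNReal.ofReal
            (auxH s2 α (auxCnt (part t) x c) (auxCnt (part t) x' c) b))]
      refine (Finset.prod_le_prod' fun c _ => auxH_bound hs2p α _ _).trans ?_
      rw [← ENNReal.ofReal_prod_of_nonneg (fun c _ => (Real.exp_pos _).le), ← Real.exp_sum]
      apply le_of_eq
      congr 2
      rw [← Finset.sum_div, ← Finset.mul_sum, hcnt, mul_one]
    · intro s hs
      rw [ENNReal.tsum_eq_zero]
      intro v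
      rw [twoStage_apply', auxK_apply_ne _ _ _ _ _ _ _ _ _ (fun h => hs h.2)]
      simp [Real.zero_rpow hα0.ne']
  refine (ENNReal.tsum_le_tsum hy).trans ?_
  rw [ENNReal.tsum_mul_right]
  refine (mul_le_mul_left (auxH_bound hs1p α _ _) _).trans ?_
  rw [← ENNReal.ofReal_mul (Real.exp_pos _).le, ← Real.exp_add, hcard]
  apply le_of_eq
  congr 2
  rw [hs1, hs2]
  field_simp
  ring
end

section
/- Positive bias of suppression-conditioned discrete Gaussian noise: Let σ > 0 and let X be distributed as the discrete Gaussian N_Z(σ²). Then for every integer c, the conditional expectation E[X | X > c] is strictly positive. Consequently, if a noisy count n + X is released only when it exceeds a suppression threshold T (i.e., conditioned on X > T − n), the expected noise in released counts is strictly positive, so suppression introduces a positive bias in the released counts. -/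
open scoped ENNReal

lemma dgauss_aux_summable {σ2 : ℝ} (h : 0 < σ2) :
    Summable fun z : ℤ => (z : ℝ) * dgaussMass σ2 z := by
  refine Summable.of_norm_bounded
    ((dgaussMass_summable (σ2 := 2 * σ2) (by linarith)).mul_left (4 * σ2)) ?_
  intro z
  have h1 : |(z : ℝ)| ≤ (z : ℝ) ^ 2 := by
    rw [← sq_abs]
    rcases eq_or_ne z 0 with rfl | hz
    · simp
    · have : (1 : ℝ) ≤ |(z : ℝ)| := by exact_mod_cast Int.one_le_abs hz
      nlinarith
  have h2 := Real.add_one_le_exp ((z : ℝ) ^ 2 / (4 * σ2))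
  have h3 : (z : ℝ) ^ 2 ≤ 4 * σ2 * Real.exp ((z : ℝ) ^ 2 / (4 * σ2)) := by
    rw [← div_le_iff₀' (by positivity)]
    linarith
  rw [norm_mul, Real.norm_eq_abs, Real.norm_eq_abs, abs_of_pos (dgaussMass_pos σ2 z)]
  have h4 : Real.exp ((z : ℝ) ^ 2 / (4 * σ2)) * dgaussMass σ2 z = dgaussMass (2 * σ2) z := by
    unfold dgaussMass
    rw [← Real.exp_add]
    congr 1
    field_simp
    ring
  rw [← h4, ← mul_assoc]
  exact mul_le_mul_of_nonneg_right (h1.trans h3) (dgaussMass_pos σ2 z).le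

/-- Positive bias of suppression-conditioned discrete Gaussian noise:
for `X ∼ N_ℤ(σ²)` with `σ² > 0` and any integer threshold `c`, the conditional
expectation `E[X | X > c] = (∑_{z > c} z·Pr[X = z]) / Pr[X > c]` is strictly positive.
In particular, releasing a noisy count `n + X` only when it exceeds a suppression
threshold `T` (i.e. conditioning on `X > T - n`, taking `c = T - n`) gives released
counts whose expected noise is strictly positive. -/
theorem dgauss_conditional_expectation_pos (σ2 : ℝ) (hσ2 : 0 < σ2) (c : ℤ) :
    0 < (∑' z : ℤ, if c < z then (z : ℝ) * ((dgaussPMF σ2) z).toReal else 0) /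
        (∑' z : ℤ, if c < z then ((dgaussPMF σ2) z).toReal else 0) := by
  set S := ∑' y : ℤ, dgaussMass σ2 y with hS
  have hS0 : 0 < S := dgaussMass_tsum_pos hσ2
  have hp : ∀ z, ((dgaussPMF σ2) z).toReal = dgaussMass σ2 z / S := by
    intro z
    have : (dgaussPMF σ2) z = ENNReal.ofReal (dgaussMass σ2 z / S) := by
      exact congrArg (fun p : PMF ℤ => p z) (dif_pos hσ2)
    rw [this, ENNReal.toReal_ofReal (div_nonneg (dgaussMass_pos σ2 z).le hS0.le)]
  simp only [hp]
  clear_value S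
  have hpos : ∀ z, 0 < dgaussMass σ2 z / S := fun z => div_pos (dgaussMass_pos σ2 z) hS0
  have heven : ∀ z, dgaussMass σ2 (-z) = dgaussMass σ2 z := by
    intro z; simp [dgaussMass]
  apply div_pos
  · set g : ℤ → ℝ := fun z => if c < z then (z : ℝ) * (dgaussMass σ2 z / S) else 0 with hg
    have hs : Summable g := by
      have h1 : Summable fun z : ℤ => (z : ℝ) * (dgaussMass σ2 z / S) := by
        simpa only [mul_div_assoc] using (dgauss_aux_summable hσ2).div_const S
      refine (h1.indicator {z | c < z}).congr ?_
      intro z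
      simp only [hg, Set.indicator_apply, Set.mem_ofPred_eq]
    have hs' : Summable fun z => g (-z) := hs.comp_injective neg_injective
    have he : ∑' z, g (-z) = ∑' z, g z := (Equiv.neg ℤ).tsum_eq g
    have hsum := hs.tsum_add hs'
    have hlt : 0 < ∑' z, (g z + g (-z)) := by
      refine (hs.add hs').tsum_pos ?_ (|c| + 1) ?_
      · intro z
        have hz := hpos z
        simp only [hg, heven]
        push_cast
        split_ifs with h1 h2 h2
        · linarith
        · have : (0 : ℝ) < z := by exact_mod_cast (by omega : 0 < z)
          rw [add_zero]
          positivity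
        · have : (0 : ℝ) < -z := by exact_mod_cast (by omega : 0 < -z)
          rw [zero_add]
          positivity
        · simp
      · have h1 : c < |c| + 1 := by have := le_abs_self c; omega
        have h2 : ¬ c < -(|c| + 1) := by have := neg_abs_le c; omega
        simp only [hg, if_pos h1, if_neg h2, add_zero]
        exact mul_pos (by exact_mod_cast (by have := abs_nonneg c; omega : 0 < |c| + 1)) (hpos _)
    rw [hsum, he] at hlt
    linarith
  · have hs : Summable fun z : ℤ => if c < z then dgaussMass σ2 z / S else 0 := by
      refine (((dgaussMass_summable hσ2).div_const S).indicator {z | c < z}).congr ?_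
      intro z
      simp only [Set.indicator_apply, Set.mem_ofPred_eq]
    refine hs.tsum_pos ?_ (c + 1) ?_
    · intro z
      split_ifs
      · exact (hpos z).le
      · exact le_rfl
    · simpa using hpos (c + 1)
end
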